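/- For every natural number n ≥ 1 and all real numbers x, y, one has x^n + y^n = Σ_{i=0}^{⌊n/2⌋} (-1)^i · (n/(n-i)) · C(n-i, i) · (xy)^i · (x+y)^{n-2i}, where C(·,·) denotes the binomial coefficient. -/

import Mathlib

/-- The coefficient `n / (n - i) * C(n - i, i)` of the Lucas polynomials. -/
noncomputable def lucasCoeff (n i : ℕ) : ℝ :=
  (n : ℝ) / ((n : ℝ) - (i : ℝ)) * ((n - i).choose i : ℝ)

theorem lucasCoeff_eq_zero {n i : ℕ} (h : n < 2 * i) : lucasCoeff n i = 0 := by
  rw [lucasCoeff, Nat.choose_eq_zero_of_lt (by omega), Nat.cast_zero, mul_zero]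

theorem lucasCoeff_zero_right {n : ℕ} (hn : 1 ≤ n) : lucasCoeff n 0 = 1 := by
  have : (n : ℝ) ≠ 0 := by positivity
  simp [lucasCoeff, this]

theorem lucasCoeff_add_two {n : ℕ} (hn : 1 ≤ n) (i : ℕ) :
    lucasCoeff (n + 2) (i + 1) = lucasCoeff (n + 1) (i + 1) + lucasCoeff n i := by
  rcases le_or_gt n i with h | h
  · rw [lucasCoeff_eq_zero (by omega), lucasCoeff_eq_zero (by omega),
      lucasCoeff_eq_zero (by omega), add_zero]
  · obtain ⟨m, rfl⟩ := Nat.exists_eq_add_of_le h.le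
    have hm : (m : ℝ) ≠ 0 := by
      have : m ≠ 0 := by omega
      exact_mod_cast this
    have hm' : (m : ℝ) + 1 ≠ 0 := by positivity
    have absorb : ((m : ℝ) + 1) * (m.choose i : ℝ)
        = ((m.choose i : ℝ) + (m.choose (i + 1) : ℝ)) * ((i : ℝ) + 1) := by
      have := Nat.add_one_mul_choose_eq m i
      rw [Nat.choose_succ_succ'] at this
      exact_mod_cast this
    simp only [lucasCoeff]
    rw [show i + m + 2 - (i + 1) = m + 1 by omega, show i + m + 1 - (i + 1) = m by omega,
      show i + m - i = m by omega, Nat.choose_succ_succ']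
    push_cast
    rw [show (i : ℝ) + m + 2 - (i + 1) = m + 1 by ring,
      show (i : ℝ) + m + 1 - (i + 1) = m by ring, show (i : ℝ) + m - i = m by ring]
    field_simp
    linear_combination absorb

/-- The Lucas polynomial in `s = x + y` and `p = x * y`, as a sum over `i < N`. -/
noncomputable def lucasSum (N n : ℕ) (s p : ℝ) : ℝ :=
  ∑ i ∈ Finset.range N, lucasCoeff n i * (-p) ^ i * s ^ (n - 2 * i)

theorem lucasSum_eq_of_le {N n : ℕ} (h : n / 2 + 1 ≤ N) (s p : ℝ) :
    lucasSum N n s p = lucasSum (n / 2 + 1) n s p := by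
  refine (Finset.sum_subset (Finset.range_mono h) fun i _ hi => ?_).symm
  rw [Finset.mem_range] at hi
  rw [lucasCoeff_eq_zero (by omega), zero_mul, zero_mul]

theorem lucasSum_add_two {n : ℕ} (hn : 1 ≤ n) (N : ℕ) (s p : ℝ) :
    lucasSum (N + 1) (n + 2) s p = s * lucasSum (N + 1) (n + 1) s p - p * lucasSum N n s p := by
  simp only [lucasSum, Finset.sum_range_succ' _ N]
  rw [mul_add, Finset.mul_sum, Finset.mul_sum, add_sub_right_comm, ← Finset.sum_sub_distrib]
  congr 1
  · refine Finset.sum_congr rfl fun i _ => ?_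
    rw [lucasCoeff_add_two hn, show n + 2 - 2 * (i + 1) = n - 2 * i by omega]
    rcases lt_or_ge (n + 1) (2 * (i + 1)) with h | h
    · rw [lucasCoeff_eq_zero h]
      ring
    · rw [show n - 2 * i = n + 1 - 2 * (i + 1) + 1 by omega]
      ring
  · rw [lucasCoeff_zero_right (by omega), lucasCoeff_zero_right (by omega)]
    simp only [mul_zero, Nat.sub_zero]
    ring

theorem pow_add_pow_eq_lucasSum {n : ℕ} (hn : 1 ≤ n) (x y : ℝ) :
    x ^ n + y ^ n = lucasSum (n / 2 + 1) n (x + y) (x * y) := by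
  induction n using Nat.strong_induction_on with
  | _ n ih =>
    match n, hn with
    | 1, _ => simp [lucasSum, lucasCoeff]
    | 2, _ =>
      norm_num [lucasSum, lucasCoeff, Finset.sum_range_succ]
      ring
    | n + 3, _ =>
      rw [← lucasSum_eq_of_le (N := n + 3 + 1) (by omega), lucasSum_add_two (by omega),
        lucasSum_eq_of_le (n := n + 1 + 1) (by omega), lucasSum_eq_of_le (n := n + 1) (by omega),
        ← ih (n + 1 + 1) (by omega) (by omega), ← ih (n + 1) (by omega) (by omega)]
      ring

theorem sum_of_powers_identity
    (n : ℕ) (hn : 1 ≤ n) (x y : ℝ) :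
    x ^ n + y ^ n =
      ∑ i ∈ Finset.range (n / 2 + 1),
        (-1 : ℝ) ^ i * ((n : ℝ) / ((n : ℝ) - (i : ℝ))) * ((n - i).choose i : ℝ) *
          (x * y) ^ i * (x + y) ^ (n - 2 * i) := by
  rw [pow_add_pow_eq_lucasSum hn, lucasSum]
  refine Finset.sum_congr rfl fun i _ => ?_
  rw [lucasCoeff, neg_pow (x * y)]
  ring
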